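/- (Proposition 3.3(ii)) One has {p ∈ M⁴ : X1(p) = 0} = ℓ₋ ∪ ℓ₊ = {p ∈ M⁴ : X3(p) = 0}, and X2(p) ≠ 0 for every p ∈ M⁴. -/

import Mathlib

noncomputable section

/-- `ℝ⁶` with its Euclidean inner product; coordinates `p 0, p 1, p 2` are `x₁, x₂, x₃`
and `p 3, p 4, p 5` are `y₁, y₂, y₃`. -/
abbrev E6 := EuclideanSpace ℝ (Fin 6)

/-- The point of `ℝ⁶` with the given six coordinates. -/
noncomputable def mk6 (a b c d e f : ℝ) : E6 :=
  (EuclideanSpace.equiv (Fin 6) ℝ).symm ![a, b, c, d, e, f]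

/-- The polynomial `F` of Proposition 3.2. -/
noncomputable def Fq (p : E6) : ℝ :=
  9 * (p 0) ^ 2 * (p 2) ^ 8 * ((p 1) ^ 2 + (p 2) ^ 2) * (p 3) ^ 2
    + 9 * (p 0) ^ 8 * (p 1) ^ 2 * ((p 0) ^ 2 - (p 2) ^ 2) * (p 4) ^ 2
    - 9 * (p 1) ^ 8 * (p 2) ^ 2 * ((p 0) ^ 2 + (p 1) ^ 2) * (p 5) ^ 2
    - (p 0) ^ 2 * (p 1) ^ 2 * (p 2) ^ 2 *
      (2 * (p 0) ^ 2 * (p 1) ^ 4 - 2 * (p 0) ^ 2 * (p 2) ^ 4 - 2 * (p 1) ^ 2 * (p 2) ^ 4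
        - (p 0) ^ 2 * (p 1) ^ 2 * (p 2) ^ 2)

/-- The polynomial `G` of Proposition 3.2. -/
noncomputable def Gq (p : E6) : ℝ := (p 1) ^ 2 - (p 0) ^ 2 - (p 2) ^ 2

/-- The algebraic variety `M⁴`. -/
def M4 : Set E6 :=
  {p | Fq p = 0 ∧ Gq p = 0 ∧ 0 < p 0 ∧ 0 < p 1 ∧ 0 < p 2 ∧ ¬(p 3 = 0 ∧ p 4 = 0 ∧ p 5 = 0)}

/-- The half line `ℓ₊`: points of `M⁴` with `x = s(1, √2, 1)`, `s > 0`, `y = (0, 1, 0)`. -/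
def ellP : Set E6 :=
  {p ∈ M4 | ∃ s : ℝ, 0 < s ∧ p 0 = s ∧ p 1 = s * Real.sqrt 2 ∧ p 2 = s ∧
    p 3 = 0 ∧ p 4 = 1 ∧ p 5 = 0}

/-- The half line `ℓ₋`: points of `M⁴` with `x = s(1, √2, 1)`, `s > 0`, `y = (0, -1, 0)`. -/
def ellM : Set E6 :=
  {p ∈ M4 | ∃ s : ℝ, 0 < s ∧ p 0 = s ∧ p 1 = s * Real.sqrt 2 ∧ p 2 = s ∧
    p 3 = 0 ∧ p 4 = -1 ∧ p 5 = 0}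

/-- The regular part `M̃⁴ = M⁴ \ (ℓ₋ ∪ ℓ₊)`. -/
def Mt4 : Set E6 := M4 \ (ellM ∪ ellP)

/-- `A₁` of Proposition 3.3. -/
noncomputable def A1 (p : E6) : ℝ :=
  (1 / (p 1) ^ 4) * (3 * (p 1) ^ 4 - (p 2) ^ 4) * (p 3) ^ 2
    - ((p 0) ^ 6 / (p 2) ^ 8) * (3 * (p 0) ^ 2 - 2 * (p 2) ^ 2) * (p 4) ^ 2
    + ((p 1) ^ 4 / ((p 0) ^ 2 * (p 2) ^ 4)) * (3 * (p 0) ^ 2 + 2 * (p 1) ^ 2) * (p 5) ^ 2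
    + (1 / (9 * (p 2) ^ 4)) * (5 * (p 0) ^ 4 + 2 * (p 1) ^ 2 * (p 2) ^ 2)

/-- `A₂` of Proposition 3.3. -/
noncomputable def A2 (p : E6) : ℝ :=
  -((p 2) ^ 4 / ((p 0) ^ 4 * (p 1) ^ 2)) * (3 * (p 1) ^ 2 + 2 * (p 2) ^ 2) * (p 3) ^ 2
    - (1 / (p 2) ^ 4) * ((p 0) ^ 4 - 3 * (p 2) ^ 4) * (p 4) ^ 2
    - ((p 1) ^ 6 / (p 0) ^ 8) * (2 * (p 0) ^ 2 + 3 * (p 1) ^ 2) * (p 5) ^ 2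
    - (1 / (9 * (p 0) ^ 4)) * (5 * (p 1) ^ 4 - 2 * (p 0) ^ 2 * (p 2) ^ 2)

/-- `A₃` of Proposition 3.3. -/
noncomputable def A3 (p : E6) : ℝ :=
  ((p 2) ^ 6 / (p 1) ^ 8) * (2 * (p 1) ^ 2 + 3 * (p 2) ^ 2) * (p 3) ^ 2
    + ((p 0) ^ 4 / ((p 1) ^ 4 * (p 2) ^ 2)) * (2 * (p 0) ^ 2 - 3 * (p 2) ^ 2) * (p 4) ^ 2
    + (1 / (p 0) ^ 4) * (3 * (p 0) ^ 4 - (p 1) ^ 4) * (p 5) ^ 2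
    + (1 / (9 * (p 1) ^ 4)) * (5 * (p 2) ^ 4 + 2 * (p 0) ^ 2 * (p 1) ^ 2)

/-- The vector field `X₁` of Proposition 3.3. -/
noncomputable def X1 (p : E6) : E6 :=
  mk6 ((1 / (p 1) ^ 4) * (((p 1) ^ 4 + (p 1) ^ 2 * (p 2) ^ 2 + (p 2) ^ 4) * p 0 * p 3))
      ((1 / (p 1) ^ 4) * ((p 1) ^ 5 * p 3))
      ((1 / (p 1) ^ 4) * ((p 2) ^ 5 * p 3))
      ((1 / (p 1) ^ 4) * ((p 1) ^ 4 * A1 p))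
      ((1 / (p 1) ^ 4) * (2 * (p 0) ^ 2 * (p 1) ^ 2 * p 3 * p 4))
      ((1 / (p 1) ^ 4) * ((8 * (p 2) ^ 2 + 2 * (p 0) ^ 2) * (p 2) ^ 2 * p 3 * p 5))

/-- The vector field `X₂` of Proposition 3.3. -/
noncomputable def X2 (p : E6) : E6 :=
  mk6 ((1 / (p 2) ^ 4) * ((p 0) ^ 5 * p 4))
      ((1 / (p 2) ^ 4) * (((p 0) ^ 4 - (p 0) ^ 2 * (p 2) ^ 2 + (p 2) ^ 4) * p 1 * p 4))
      ((1 / (p 2) ^ 4) * ((p 2) ^ 5 * p 4))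
      ((1 / (p 2) ^ 4) * ((8 * (p 0) ^ 2 - 2 * (p 1) ^ 2) * (p 0) ^ 2 * p 3 * p 4))
      ((1 / (p 2) ^ 4) * ((p 2) ^ 4 * A2 p))
      ((1 / (p 2) ^ 4) * (2 * (p 1) ^ 2 * (p 2) ^ 2 * p 4 * p 5))

/-- The vector field `X₃` of Proposition 3.3. -/
noncomputable def X3 (p : E6) : E6 :=
  mk6 ((1 / (p 0) ^ 4) * ((p 0) ^ 5 * p 5))
      ((1 / (p 0) ^ 4) * ((p 1) ^ 5 * p 5))
      ((1 / (p 0) ^ 4) * (((p 0) ^ 4 + (p 0) ^ 2 * (p 1) ^ 2 + (p 1) ^ 4) * p 2 * p 5))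
      ((1 / (p 0) ^ 4) * (-2 * (p 0) ^ 2 * (p 2) ^ 2 * p 3 * p 5))
      ((1 / (p 0) ^ 4) * ((8 * (p 1) ^ 2 - 2 * (p 2) ^ 2) * (p 1) ^ 2 * p 4 * p 5))
      ((1 / (p 0) ^ 4) * ((p 0) ^ 4 * A3 p))

/-- The indexed family `X₁, X₂, X₃`. -/
noncomputable def Xv : Fin 3 → E6 → E6 := ![X1, X2, X3]

theorem mk6_eq_zero_iff {a b c d e f : ℝ} :
    mk6 a b c d e f = 0 ↔ a = 0 ∧ b = 0 ∧ c = 0 ∧ d = 0 ∧ e = 0 ∧ f = 0 := by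
  rw [mk6, ContinuousLinearEquiv.map_eq_zero_iff]
  simp

/-- On the positive octant `X₁` vanishes exactly where `y₁` and `A₁` do. -/
theorem X1_eq_zero_iff {p : E6} (h1 : 0 < p 1) : X1 p = 0 ↔ p 3 = 0 ∧ A1 p = 0 := by
  rw [X1, mk6_eq_zero_iff]
  constructor
  · rintro ⟨-, h, -, h', -, -⟩
    exact ⟨by simpa [h1.ne'] using h, by simpa [h1.ne'] using h'⟩
  · rintro ⟨h, h'⟩
    simp [h, h']

/-- On the positive octant `X₃` vanishes exactly where `y₃` and `A₃` do. -/
theorem X3_eq_zero_iff {p : E6} (h0 : 0 < p 0) : X3 p = 0 ↔ p 5 = 0 ∧ A3 p = 0 := by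
  rw [X3, mk6_eq_zero_iff]
  constructor
  · rintro ⟨h, -, -, -, -, h'⟩
    exact ⟨by simpa [h0.ne'] using h, by simpa [h0.ne'] using h'⟩
  · rintro ⟨h, h'⟩
    simp [h, h']

/-- The two half lines together, described without square roots. -/
theorem mem_ell_union_iff {p : E6} : p ∈ ellM ∪ ellP ↔
    p ∈ M4 ∧ (p 0) ^ 2 = (p 2) ^ 2 ∧ p 3 = 0 ∧ (p 4) ^ 2 = 1 ∧ p 5 = 0 := by
  constructor
  · rintro (⟨hM, s, -, h0, -, h2, h3, h4, h5⟩ | ⟨hM, s, -, h0, -, h2, h3, h4, h5⟩) <;>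
      exact ⟨hM, by rw [h0, h2], h3, by norm_num [h4], h5⟩
  · rintro ⟨hM, h02, h3, h4, h5⟩
    obtain ⟨-, hG, h0, h1, h2, -⟩ := id hM
    have h20 : p 2 = p 0 := ((sq_eq_sq₀ h0.le h2.le).1 h02).symm
    have h10 : p 1 = p 0 * Real.sqrt 2 := by
      refine (sq_eq_sq₀ h1.le (by positivity)).1 ?_
      rw [mul_pow, Real.sq_sqrt zero_le_two]
      rw [Gq] at hG
      linarith
    rcases (sq_eq_sq_iff_eq_or_eq_neg.1 (h4.trans (one_pow 2).symm)) with h | h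
    · exact Or.inr ⟨hM, p 0, h0, rfl, h10, h20, h3, h, h5⟩
    · exact Or.inl ⟨hM, p 0, h0, rfl, h10, h20, h3, h, h5⟩

/-- In the variables `a = x₁²`, `c = x₃²`, `v = y₂²`, `w = y₃²`, with `x₂² = a + c` and `y₁ = 0`,
the equations `F = 0` and `A₁ = 0` determine the direction of `x` and the values of `v`, `w`. -/
theorem eq_of_F_A1 {a c v w : ℝ} (ha : 0 < a) (hc : 0 < c) (hw : 0 ≤ w)
    (hF : 9 * a ^ 4 * (a + c) * (a - c) * v - 9 * (a + c) ^ 4 * c * (2 * a + c) * w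
      = a * (a + c) * c * (a - c) * (2 * a + c) * (a + 2 * c))
    (hA : 9 * a ^ 4 * (3 * a - 2 * c) * v
      = 9 * (a + c) ^ 2 * c ^ 2 * (5 * a + 2 * c) * w
        + a * c ^ 2 * (5 * a ^ 2 + 2 * a * c + 2 * c ^ 2)) :
    a = c ∧ v = 1 ∧ w = 0 := by
  have key : (6 * a * c * (a + c) ^ 3) * (9 * a ^ 2 * w + (a - c) ^ 2) = 0 := by
    linear_combination (-(3 * a - 2 * c)) * hF + (a + c) * (a - c) * hA
  have hsum : 9 * a ^ 2 * w + (a - c) ^ 2 = 0 :=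
    (mul_eq_zero.1 key).resolve_left (by positivity)
  obtain ⟨hw', hac⟩ := (add_eq_zero_iff_of_nonneg (by positivity) (by positivity)).1 hsum
  have hw0 : w = 0 := (mul_eq_zero.1 hw').resolve_left (by positivity)
  obtain rfl : a = c := sub_eq_zero.1 (pow_eq_zero_iff two_ne_zero |>.1 hac)
  refine ⟨rfl, ?_, hw0⟩
  subst hw0
  have h : (9 * a ^ 5) * v = (9 * a ^ 5) * 1 := by linear_combination hA
  exact mul_left_cancel₀ (by positivity) h

/-- In the variables `a = x₁²`, `c = x₃²`, `u = y₁²`, `v = y₂²`, with `x₂² = a + c` and `y₃ = 0`,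
the equations `F = 0` and `A₃ = 0` determine the direction of `x` and the values of `u`, `v`. -/
theorem eq_of_F_A3 {a c u v : ℝ} (ha : 0 < a) (hc : 0 < c) (hu : 0 ≤ u)
    (hF : 9 * a * c ^ 4 * (a + 2 * c) * u + 9 * a ^ 4 * (a + c) * (a - c) * v
      = a * (a + c) * c * (a - c) * (2 * a + c) * (a + 2 * c))
    (hA : 9 * c ^ 4 * (2 * a + 5 * c) * u + 9 * a ^ 2 * (a + c) ^ 2 * (2 * a - 3 * c) * v
      + (a + c) ^ 2 * c * (2 * a ^ 2 + 2 * a * c + 5 * c ^ 2) = 0) :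
    a = c ∧ u = 0 ∧ v = 1 := by
  have key : (6 * a * c) * (9 * c ^ 6 * u + (a + c) ^ 4 * (a - c) ^ 2) = 0 := by
    linear_combination (-(a + c) * (2 * a - 3 * c)) * hF + a ^ 2 * (a - c) * hA
  have hsum : 9 * c ^ 6 * u + (a + c) ^ 4 * (a - c) ^ 2 = 0 :=
    (mul_eq_zero.1 key).resolve_left (by positivity)
  obtain ⟨hu', hac'⟩ := (add_eq_zero_iff_of_nonneg (by positivity) (by positivity)).1 hsum
  have hu0 : u = 0 := (mul_eq_zero.1 hu').resolve_left (by positivity)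
  have hac : (a - c) ^ 2 = 0 := (mul_eq_zero.1 hac').resolve_left (by positivity)
  obtain rfl : a = c := sub_eq_zero.1 (pow_eq_zero_iff two_ne_zero |>.1 hac)
  refine ⟨rfl, hu0, ?_⟩
  subst hu0
  have h : (36 * a ^ 5) * v = (36 * a ^ 5) * 1 := by linear_combination -hA
  exact mul_left_cancel₀ (by positivity) h

theorem A1_clear_denominators {p : E6} (h0 : 0 < p 0) (h2 : 0 < p 2) (h3 : p 3 = 0) :
    9 * (p 0) ^ 2 * (p 2) ^ 8 * A1 p
      = 9 * (p 1) ^ 4 * (p 2) ^ 4 * (3 * (p 0) ^ 2 + 2 * (p 1) ^ 2) * (p 5) ^ 2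
        - 9 * (p 0) ^ 8 * (3 * (p 0) ^ 2 - 2 * (p 2) ^ 2) * (p 4) ^ 2
        + (p 0) ^ 2 * (p 2) ^ 4 * (5 * (p 0) ^ 4 + 2 * (p 1) ^ 2 * (p 2) ^ 2) := by
  rw [A1, h3]
  field_simp
  ring

theorem A3_clear_denominators {p : E6} (h1 : 0 < p 1) (h2 : 0 < p 2) (h5 : p 5 = 0) :
    9 * (p 1) ^ 8 * (p 2) ^ 2 * A3 p
      = 9 * (p 2) ^ 8 * (2 * (p 1) ^ 2 + 3 * (p 2) ^ 2) * (p 3) ^ 2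
        + 9 * (p 0) ^ 4 * (p 1) ^ 4 * (2 * (p 0) ^ 2 - 3 * (p 2) ^ 2) * (p 4) ^ 2
        + (p 1) ^ 4 * (p 2) ^ 2 * (5 * (p 2) ^ 4 + 2 * (p 0) ^ 2 * (p 1) ^ 2) := by
  rw [A3, h5]
  field_simp
  ring

theorem X1_eq_zero_iff_mem_ell {p : E6} (hp : p ∈ M4) : X1 p = 0 ↔ p ∈ ellM ∪ ellP := by
  obtain ⟨hF, hG, h0, h1, h2, -⟩ := id hp
  have hb : (p 1) ^ 2 = (p 0) ^ 2 + (p 2) ^ 2 := by rw [Gq] at hG; linarith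
  rw [X1_eq_zero_iff h1, mem_ell_union_iff]
  constructor
  · rintro ⟨h3, hA⟩
    have hA' := A1_clear_denominators h0 h2 h3
    rw [hA, show (p 1) ^ 4 = ((p 1) ^ 2) ^ 2 by ring, hb] at hA'
    rw [Fq, h3, show (p 1) ^ 8 = ((p 1) ^ 2) ^ 4 by ring,
      show (p 1) ^ 4 = ((p 1) ^ 2) ^ 2 by ring, hb] at hF
    obtain ⟨hac, hv, hw⟩ := eq_of_F_A1 (pow_pos h0 2) (pow_pos h2 2) (sq_nonneg (p 5))
      (v := (p 4) ^ 2) (by linear_combination hF) (by linear_combination hA')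
    exact ⟨hp, hac, h3, hv, pow_eq_zero_iff two_ne_zero |>.1 hw⟩
  · rintro ⟨-, hac, h3, hv, h5⟩
    refine ⟨h3, ?_⟩
    have hA' := A1_clear_denominators h0 h2 h3
    rw [show (p 0) ^ 8 = ((p 0) ^ 2) ^ 4 by ring, show (p 0) ^ 4 = ((p 0) ^ 2) ^ 2 by ring,
      hb, hac, hv, h5] at hA'
    have h : 9 * (p 2) ^ 2 * (p 2) ^ 8 * A1 p = 0 := by linear_combination hA'
    exact (mul_eq_zero.1 h).resolve_left (by positivity)

theorem X3_eq_zero_iff_mem_ell {p : E6} (hp : p ∈ M4) : X3 p = 0 ↔ p ∈ ellM ∪ ellP := by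
  obtain ⟨hF, hG, h0, h1, h2, -⟩ := id hp
  have hb : (p 1) ^ 2 = (p 0) ^ 2 + (p 2) ^ 2 := by rw [Gq] at hG; linarith
  rw [X3_eq_zero_iff h0, mem_ell_union_iff]
  constructor
  · rintro ⟨h5, hA⟩
    have hA' := A3_clear_denominators h1 h2 h5
    rw [hA, show (p 1) ^ 4 = ((p 1) ^ 2) ^ 2 by ring, hb] at hA'
    rw [Fq, h5, show (p 1) ^ 4 = ((p 1) ^ 2) ^ 2 by ring, hb] at hF
    obtain ⟨hac, hu, hv⟩ := eq_of_F_A3 (pow_pos h0 2) (pow_pos h2 2) (sq_nonneg (p 3))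
      (v := (p 4) ^ 2) (by linear_combination hF) (by linear_combination -hA')
    exact ⟨hp, hac, pow_eq_zero_iff two_ne_zero |>.1 hu, hv, h5⟩
  · rintro ⟨-, hac, h3, hv, h5⟩
    refine ⟨h5, ?_⟩
    have hA' := A3_clear_denominators h1 h2 h5
    have h : 9 * (p 1) ^ 8 * (p 2) ^ 2 * A3 p = 0 := by
      rw [hA', show (p 0) ^ 4 = ((p 0) ^ 2) ^ 2 by ring,
        show (p 1) ^ 4 = ((p 1) ^ 2) ^ 2 by ring, hb, hac, hv, h3]
      ring
    exact (mul_eq_zero.1 h).resolve_left (by positivity)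

theorem A2_neg {p : E6} (hp : p ∈ M4) (h4 : p 4 = 0) : A2 p < 0 := by
  obtain ⟨-, hG, h0, h1, h2, -⟩ := hp
  have hb : (p 1) ^ 2 = (p 0) ^ 2 + (p 2) ^ 2 := by rw [Gq] at hG; linarith
  have hu : 0 ≤ (p 2) ^ 4 / ((p 0) ^ 4 * (p 1) ^ 2) * (3 * (p 1) ^ 2 + 2 * (p 2) ^ 2)
      * (p 3) ^ 2 := by positivity
  have hw : 0 ≤ (p 1) ^ 6 / (p 0) ^ 8 * (2 * (p 0) ^ 2 + 3 * (p 1) ^ 2) * (p 5) ^ 2 := by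
    positivity
  have hk : 0 < 5 * (p 1) ^ 4 - 2 * (p 0) ^ 2 * (p 2) ^ 2 := by
    have : 5 * (p 1) ^ 4 - 2 * (p 0) ^ 2 * (p 2) ^ 2
        = 5 * (p 0) ^ 4 + 8 * (p 0) ^ 2 * (p 2) ^ 2 + 5 * (p 2) ^ 4 := by
      rw [show (p 1) ^ 4 = ((p 1) ^ 2) ^ 2 by ring, hb]
      ring
    rw [this]
    positivity
  have hk' : 0 < 1 / (9 * (p 0) ^ 4) * (5 * (p 1) ^ 4 - 2 * (p 0) ^ 2 * (p 2) ^ 2) := by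
    positivity
  rw [A2, h4]
  linarith

theorem X2_ne_zero {p : E6} (hp : p ∈ M4) : X2 p ≠ 0 := by
  have h2 : 0 < p 2 := hp.2.2.2.2.1
  rw [X2, Ne, mk6_eq_zero_iff]
  rintro ⟨-, -, h, -, h', -⟩
  exact (A2_neg hp (by simpa [h2.ne'] using h)).ne (by simpa [h2.ne'] using h')

/-- Proposition 3.3(ii): the zero sets of `X₁` and `X₃` on `M⁴` are both `ℓ₋ ∪ ℓ₊`,
and `X₂` never vanishes on `M⁴`. -/
theorem statement_15 :
    {p ∈ M4 | X1 p = 0} = ellM ∪ ellP ∧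
    {p ∈ M4 | X3 p = 0} = ellM ∪ ellP ∧
    (∀ p ∈ M4, X2 p ≠ 0) := by
  refine ⟨Set.ext fun p => ?_, Set.ext fun p => ?_, fun p hp => X2_ne_zero hp⟩
  · exact ⟨fun h => (X1_eq_zero_iff_mem_ell h.1).1 h.2, fun h =>
      have hp : p ∈ M4 := (mem_ell_union_iff.1 h).1
      ⟨hp, (X1_eq_zero_iff_mem_ell hp).2 h⟩⟩
  · exact ⟨fun h => (X3_eq_zero_iff_mem_ell h.1).1 h.2, fun h =>
      have hp : p ∈ M4 := (mem_ell_union_iff.1 h).1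
      ⟨hp, (X3_eq_zero_iff_mem_ell hp).2 h⟩⟩
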